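/- arXiv:2602.00885 — 3 statements merged into one kernel-verified Lean document; each statement's English description precedes it below -/
import Mathlib

section
/- Let n be a finite index type, G a positive semidefinite real n×n matrix, and α : n → ℝ with 0 ≤ α(i) ≤ 1 for all i and α(i₀) < 1 for some index i₀. For a Boolean mask z : n → Bool let M(z) be the 0/1 diagonal matrix of the mask and p(z) = ∏_i (α(i) if z(i) else 1 − α(i)). Then the extended-real expected log-determinant collapses: ∑_{z : n → Bool} p(z) · log(det(M(z)·G·M(z))) = −∞, where the sum is taken in the extended reals and log is the extended-real logarithm of a nonnegative real (so log(0) = −∞). -/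
/-- Extended-real logarithm of a nonnegative real number: `elog 0 = ⊥`. -/
noncomputable def elog (x : ℝ) : EReal :=
  if x = 0 then ⊥ else (Real.log x : EReal)

theorem Matrix.det_diagonal_mul_mul_diagonal_eq_zero {n R : Type*} [Fintype n] [DecidableEq n]
    [CommRing R] (A : Matrix n n R) {d : n → R} {i : n} (hi : d i = 0) :
    (Matrix.diagonal d * A * Matrix.diagonal d).det = 0 := by
  rw [Matrix.det_mul, Matrix.det_diagonal, Finset.prod_eq_zero (Finset.mem_univ i) hi, mul_zero]

/-- A unit that can drop is absent from some mask of positive probability. -/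
theorem exists_mask_eq_false_and_prod_pos {n : Type*} [Fintype n] {α : n → ℝ}
    {i₀ : n} (hi₀ : α i₀ < 1) :
    ∃ z : n → Bool, z i₀ = false ∧ 0 < ∏ i, (if z i then α i else 1 - α i) := by
  classical
  refine ⟨fun i => decide (i ≠ i₀ ∧ 0 < α i), by simp, Finset.prod_pos fun i _ => ?_⟩
  by_cases h : i ≠ i₀ ∧ 0 < α i
  · rw [if_pos (decide_eq_true h)]
    exact h.2
  · rw [if_neg (by simpa only [decide_eq_true_eq] using h), sub_pos]
    rcases eq_or_ne i i₀ with rfl | hne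
    · exact hi₀
    · have : ¬ 0 < α i := fun hpos => h ⟨hne, hpos⟩
      linarith

theorem naive_expected_logdet_collapses
    {n : Type*} [Fintype n] [DecidableEq n]
    (G : Matrix n n ℝ) (hG : G.PosSemidef) (α : n → ℝ)
    (hα : ∀ i, 0 ≤ α i ∧ α i ≤ 1) (i₀ : n) (hi₀ : α i₀ < 1) :
    ∑ z : n → Bool,
        ((∏ i, (if z i then α i else 1 - α i) : ℝ) : EReal) *
          elog ((Matrix.diagonal (fun i => if z i then (1 : ℝ) else 0) * G *
                 Matrix.diagonal (fun i => if z i then (1 : ℝ) else 0)).det)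
      = ⊥ := by
  obtain ⟨z, hz, hpos⟩ := exists_mask_eq_false_and_prod_pos hi₀
  rw [← Finset.add_sum_erase _ _ (Finset.mem_univ z),
    Matrix.det_diagonal_mul_mul_diagonal_eq_zero G (i := i₀) (by simp [hz]),
    elog, if_pos rfl, EReal.coe_mul_bot_of_pos hpos, EReal.bot_add]
end

section
/- Let n be a finite index type, G a positive definite real n×n matrix, ε > 0, and α : n → ℝ with 0 ≤ α(i) ≤ 1 for all i. For a Boolean mask z : n → Bool, let W(z) = diagonal(fun i => (1 if z(i) else 0) + ε) and p(z) = ∏_i (α(i) if z(i) else 1 − α(i)). Then the expected regularized log-determinant decomposes exactly: ∑_{z : n → Bool} p(z) · log det(W(z) · G · W(z)) = log det(G) + ∑_i 2·(α(i)·log(1+ε) + (1 − α(i))·log ε). -/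
/-- The total mass of a product of weights that each sum to one is one. -/
theorem sum_prod_weight_eq_one {ι κ R : Type*} [Fintype ι] [DecidableEq ι] [Fintype κ]
    [CommSemiring R] (p : ι → κ → R) (hp : ∀ i, ∑ b, p i b = 1) :
    ∑ x : ι → κ, ∏ i, p i (x i) = 1 := by
  rw [← Fintype.prod_sum]
  simp [hp]

/-- Under a product of weights that each sum to one, the expectation of a function of a single
coordinate is its expectation under the corresponding marginal. -/
theorem sum_prod_weight_mul_apply {ι κ R : Type*} [Fintype ι] [DecidableEq ι] [Fintype κ]
    [CommSemiring R] (p : ι → κ → R) (hp : ∀ i, ∑ b, p i b = 1) (j : ι) (f : κ → R) :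
    ∑ x : ι → κ, (∏ i, p i (x i)) * f (x j) = ∑ b, p j b * f b := by
  have h (x : ι → κ) : (∏ i, p i (x i)) * f (x j) =
      ∏ i, p i (x i) * (if i = j then f (x i) else 1) := by
    rw [Finset.prod_mul_distrib, Fintype.prod_ite_eq']
  simp_rw [h]
  rw [← Fintype.prod_sum (fun i b => p i b * (if i = j then f b else 1)),
    Fintype.prod_eq_single j]
  · simp
  · intro i hij
    simp [hij, hp]

theorem log_det_diagonal_mul_mul_diagonal {n : Type*} [Fintype n] [DecidableEq n]
    (G : Matrix n n ℝ) (hG : G.det ≠ 0) (w : n → ℝ) (hw : ∀ i, w i ≠ 0) :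
    Real.log (Matrix.diagonal w * G * Matrix.diagonal w).det =
      Real.log G.det + ∑ i, 2 * Real.log (w i) := by
  have hprod : ∏ i, w i ≠ 0 := Finset.prod_ne_zero_iff.mpr fun i _ => hw i
  rw [Matrix.det_mul, Matrix.det_mul, Matrix.det_diagonal,
    Real.log_mul (mul_ne_zero hprod hG) hprod, Real.log_mul hprod hG,
    Real.log_prod fun i _ => hw i, ← Finset.mul_sum]
  ring

theorem expected_regularized_logdet_decomposition
    {n : Type*} [Fintype n] [DecidableEq n]
    (G : Matrix n n ℝ) (hG : G.PosDef) (ε : ℝ) (hε : 0 < ε)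
    (α : n → ℝ) (hα : ∀ i, 0 ≤ α i ∧ α i ≤ 1) :
    ∑ z : n → Bool,
        (∏ i, (if z i then α i else 1 - α i)) *
          Real.log ((Matrix.diagonal (fun i => (if z i then (1 : ℝ) else 0) + ε) * G *
                     Matrix.diagonal (fun i => (if z i then (1 : ℝ) else 0) + ε)).det)
      = Real.log G.det
        + ∑ i, 2 * (α i * Real.log (1 + ε) + (1 - α i) * Real.log ε) := by
  have hw (z : n → Bool) (i : n) : (if z i then (1 : ℝ) else 0) + ε ≠ 0 := by
    split_ifs <;> positivity
  simp_rw [fun z => log_det_diagonal_mul_mul_diagonal G hG.det_pos.ne' _ (hw z), mul_add,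
    Finset.sum_add_distrib, ← Finset.sum_mul, Finset.mul_sum]
  let p : n → Bool → ℝ := fun i b => if b then α i else 1 - α i
  have hp (i : n) : ∑ b, p i b = 1 := by simp [p]
  congr 1
  · rw [sum_prod_weight_eq_one p hp, one_mul]
  · rw [Finset.sum_comm, ← Finset.sum_add_distrib]
    refine Finset.sum_congr rfl fun j _ => ?_
    rw [sum_prod_weight_mul_apply p hp j
      fun b => 2 * Real.log ((if b then (1 : ℝ) else 0) + ε)]
    simp [p]
    ring
end

section
/- Let n be a finite index type, 𝒜 a nonempty finite collection of finite subsets of n each of cardinality K ≥ 1, g : Finset n → ℝ, and θ, θ̃ : n → ℝ with θ(i) ≤ θ̃(i) for all i. Suppose A⋆ ∈ 𝒜 maximizes a ↦ g(a) + ∑_{i∈a} θ(i), A ∈ 𝒜 maximizes a ↦ g(a) + ∑_{i∈a} θ̃(i), and let Δ = (g(A⋆) + ∑_{i∈A⋆} θ(i)) − (g(A) + ∑_{i∈A} θ(i)). Then there exists an item i ∈ A with θ̃(i) − θ(i) ≥ Δ / K. -/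
theorem suboptimality_charged_to_item
    {n : Type*} [DecidableEq n]
    (𝒜 : Finset (Finset n)) (h𝒜 : 𝒜.Nonempty) (K : ℕ) (hK : 1 ≤ K)
    (hcard : ∀ a ∈ 𝒜, a.card = K)
    (g : Finset n → ℝ) (θ θ' : n → ℝ) (hθ : ∀ i, θ i ≤ θ' i)
    (Astar A : Finset n) (hAstar : Astar ∈ 𝒜) (hA : A ∈ 𝒜)
    (hAstarOpt : ∀ a ∈ 𝒜, g a + ∑ i ∈ a, θ i ≤ g Astar + ∑ i ∈ Astar, θ i)
    (hAOpt : ∀ a ∈ 𝒜, g a + ∑ i ∈ a, θ' i ≤ g A + ∑ i ∈ A, θ' i)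
    (Δ : ℝ)
    (hΔ : Δ = (g Astar + ∑ i ∈ Astar, θ i) - (g A + ∑ i ∈ A, θ i)) :
    ∃ i ∈ A, Δ / K ≤ θ' i - θ i := by
  have hAcard : A.card = K := hcard A hA
  have hne : A.Nonempty := Finset.card_pos.mp (by omega)
  have hK0 : (K : ℝ) ≠ 0 := by exact_mod_cast (by omega : K ≠ 0)
  refine Finset.exists_le_of_sum_le hne ?_
  rw [Finset.sum_const, hAcard, nsmul_eq_mul, mul_div_cancel₀ _ hK0, Finset.sum_sub_distrib]
  have hopt := hAOpt Astar hAstar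
  have hoptimism : ∑ i ∈ Astar, θ i ≤ ∑ i ∈ Astar, θ' i := Finset.sum_le_sum fun i _ => hθ i
  linarith
end
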